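/- A homogeneous polynomial f of degree d in n+1 variables has the property that every line ℓ ⊆ P^n fails to meet V(f) transversally in d distinct smooth points (i.e., the restriction of f to every line has a repeated root) if and only if f is divisible by the square of some non-constant homogeneous polynomial. -/

import Mathlib

open MvPolynomial

section Homogeneous

variable {σ R A : Type*} [CommRing R] [CommRing A] [Algebra R A]

/-- Evaluating a form of degree `d` at a multiple `z • u` scales its value at `u` by `z ^ d`. -/
theorem MvPolynomial.IsHomogeneous.aeval_mul {f : MvPolynomial σ R} {d : ℕ}
    (hf : f.IsHomogeneous d) (z : A) (u : σ → A) :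
    MvPolynomial.aeval (fun i => z * u i) f = z ^ d * MvPolynomial.aeval u f := by
  rw [aeval_def, aeval_def, eval₂_eq, eval₂_eq, Finset.mul_sum]
  refine Finset.sum_congr rfl fun m hm => ?_
  have hdeg : ∑ i ∈ m.support, m i = d := (hf.degree_eq_sum_deg_support hm).symm
  simp only [mul_pow, Finset.prod_mul_distrib, Finset.prod_pow_eq_pow_sum, hdeg]
  ring

theorem natDegree_prod_linear_le (s : Finset σ) (m : σ → ℕ) (a b : σ → A) :
    (∏ i ∈ s, (Polynomial.C (a i) + Polynomial.X * Polynomial.C (b i)) ^ m i).natDegree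
      ≤ ∑ i ∈ s, m i := by
  refine (Polynomial.natDegree_prod_le _ _).trans (Finset.sum_le_sum fun i _ => ?_)
  refine Polynomial.natDegree_pow_le_of_le (m i) (m := 1) ?_ |>.trans (by simp)
  compute_degree

theorem coeff_prod_linear (s : Finset σ) (m : σ → ℕ) (a b : σ → A) :
    (∏ i ∈ s, (Polynomial.C (a i) + Polynomial.X * Polynomial.C (b i)) ^ m i).coeff
      (∑ i ∈ s, m i) = ∏ i ∈ s, b i ^ m i := by
  classical
  induction s using Finset.induction_on with
  | empty => simp
  | insert j s hj ih =>
    have hlin : (Polynomial.C (a j) + Polynomial.X * Polynomial.C (b j)).natDegree ≤ 1 := by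
      compute_degree
    have hpow : ((Polynomial.C (a j) + Polynomial.X * Polynomial.C (b j)) ^ m j).natDegree
        ≤ m j := by
      simpa using Polynomial.natDegree_pow_le_of_le (m j) hlin
    have hcoeff := Polynomial.coeff_pow_of_natDegree_le (m := m j) hlin
    rw [Finset.prod_insert hj, Finset.sum_insert hj, Finset.prod_insert hj,
      Polynomial.coeff_mul_add_eq_of_natDegree_le hpow (natDegree_prod_linear_le s m a b), ih]
    rw [mul_one] at hcoeff
    rw [hcoeff]
    simp

/-- The restriction of a form of degree `d` to the line `a + X b` has degree at most `d`. -/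
theorem MvPolynomial.IsHomogeneous.natDegree_aeval_line_le {f : MvPolynomial σ R} {d : ℕ}
    (hf : f.IsHomogeneous d) (a b : σ → A) :
    (MvPolynomial.aeval (fun i => Polynomial.C (a i) + Polynomial.X * Polynomial.C (b i)) f).natDegree
      ≤ d := by
  rw [aeval_def, eval₂_eq]
  refine Polynomial.natDegree_sum_le_of_forall_le _ _ fun m hm => ?_
  have hdeg : ∑ i ∈ m.support, m i = d := (hf.degree_eq_sum_deg_support hm).symm
  rw [Polynomial.algebraMap_apply]
  refine (Polynomial.natDegree_C_mul_le _ _).trans ?_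
  exact hdeg ▸ natDegree_prod_linear_le m.support m a b

/-- The coefficient of `X ^ d` in the restriction of a form of degree `d` to the line `a + X b`
is the value of the form at `b`. -/
theorem MvPolynomial.IsHomogeneous.coeff_aeval_line {f : MvPolynomial σ R} {d : ℕ}
    (hf : f.IsHomogeneous d) (a b : σ → A) :
    (MvPolynomial.aeval (fun i => Polynomial.C (a i) + Polynomial.X * Polynomial.C (b i)) f).coeff d
      = MvPolynomial.aeval b f := by
  rw [aeval_def, eval₂_eq, aeval_def, eval₂_eq, Polynomial.finsetSum_coeff]
  refine Finset.sum_congr rfl fun m hm => ?_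
  have hdeg : ∑ i ∈ m.support, m i = d := (hf.degree_eq_sum_deg_support hm).symm
  rw [Polynomial.algebraMap_apply, Polynomial.coeff_C_mul, ← hdeg,
    coeff_prod_linear]

theorem MvPolynomial.homogeneousComponent_mul_of_totalDegree_le {p q : MvPolynomial σ R}
    {m n : ℕ} (hp : p.totalDegree ≤ m) (hq : q.totalDegree ≤ n) :
    homogeneousComponent (m + n) (p * q)
      = homogeneousComponent m p * homogeneousComponent n q := by
  classical
  ext e
  have hmul := (homogeneousComponent_isHomogeneous m p).mul
    (homogeneousComponent_isHomogeneous n q)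
  rw [coeff_homogeneousComponent]
  split_ifs with he
  · rw [coeff_mul, coeff_mul]
    refine Finset.sum_congr rfl fun x hx => ?_
    have hx' : x.1.degree + x.2.degree = m + n := by
      rw [← he, ← Finset.HasAntidiagonal.mem_antidiagonal.mp hx, map_add]
    rw [coeff_homogeneousComponent, coeff_homogeneousComponent]
    rcases lt_trichotomy x.1.degree m with h | h | h
    · have : coeff x.2 q = 0 := coeff_eq_zero_of_totalDegree_lt
        (lt_of_le_of_lt hq (show n < x.2.degree by omega))
      simp [this]
    · rw [if_pos h, if_pos (by omega)]
    · have : coeff x.1 p = 0 := coeff_eq_zero_of_totalDegree_lt (lt_of_le_of_lt hp h)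
      simp [this]
  · exact (hmul.coeff_eq_zero he).symm

end Homogeneous

/-- If the square of a non-constant polynomial divides a nonzero form, so does the square of a
form of positive degree. -/
theorem MvPolynomial.IsHomogeneous.exists_isHomogeneous_sq_dvd {σ R : Type*} [CommRing R]
    [IsDomain R] {f q : MvPolynomial σ R} {d : ℕ} (hf : f.IsHomogeneous d) (hf0 : f ≠ 0)
    (hq : q ^ 2 ∣ f) :
    ∃ g : MvPolynomial σ R, g.IsHomogeneous q.totalDegree ∧ g ^ 2 ∣ f := by
  obtain ⟨r, rfl⟩ := hq
  have hr : r ≠ 0 := right_ne_zero_of_mul hf0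
  have hq0 : q ≠ 0 := by
    rintro rfl
    simp at hf0
  have hd : d = q.totalDegree + q.totalDegree + r.totalDegree := by
    rw [← hf.totalDegree hf0, totalDegree_mul_of_isDomain (pow_ne_zero 2 hq0) hr, sq,
      totalDegree_mul_of_isDomain hq0 hq0]
  refine ⟨homogeneousComponent q.totalDegree q, homogeneousComponent_isHomogeneous _ _,
    homogeneousComponent r.totalDegree r, ?_⟩
  rw [sq (homogeneousComponent _ _), ← homogeneousComponent_mul_of_totalDegree_le le_rfl le_rfl,
    ← homogeneousComponent_mul_of_totalDegree_le (totalDegree_mul _ _) le_rfl, ← hd, ← sq,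
    homogeneousComponent_eq_self hf]

/-- A binary form vanishing at a point is divisible by the linear form vanishing there. -/
theorem MvPolynomial.IsHomogeneous.linear_dvd_of_aeval_eq_zero {k : Type*} [Field k]
    {p : MvPolynomial (Fin 2) k} {m : ℕ} (hp : p.IsHomogeneous m) (u : Fin 2 → k) (hu : u ≠ 0)
    (h : MvPolynomial.aeval u p = 0) : (C (u 1) * X 0 + C (-u 0) * X 1 : MvPolynomial (Fin 2) k) ∣ p := by
  set l : MvPolynomial (Fin 2) k := C (u 1) * X 0 + C (-u 0) * X 1
  let S := MvPolynomial (Fin 2) k ⧸ Ideal.span {l}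
  let π : MvPolynomial (Fin 2) k →ₐ[k] S := Ideal.Quotient.mkₐ k (Ideal.span {l})
  have hrel : algebraMap k S (u 1) * π (X 0) = algebraMap k S (u 0) * π (X 1) := by
    have h0 : π (C (u 1) * X 0 + C (-u 0) * X 1) = 0 := Ideal.Quotient.eq_zero_iff_mem.mpr (Ideal.mem_span_singleton_self l)
    have hC : ∀ c : k, π (C c) = algebraMap k S c := fun c => π.commutes c
    rw [map_add, map_mul, map_mul, hC, hC, map_neg] at h0
    linear_combination h0
  obtain ⟨z, hz⟩ : ∃ z : S, ∀ i, π (X i) = z * algebraMap k S (u i) := by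
    obtain ⟨j, hj⟩ := Function.ne_iff.mp hu
    have hj' : algebraMap k S (u j)⁻¹ * algebraMap k S (u j) = 1 := by
      rw [← map_mul, inv_mul_cancel₀ hj, map_one]
    refine ⟨algebraMap k S (u j)⁻¹ * π (X j), fun i => ?_⟩
    have hij : algebraMap k S (u j) * π (X i) = algebraMap k S (u i) * π (X j) := by
      fin_cases i <;> fin_cases j <;> first | rfl | exact hrel | exact hrel.symm
    linear_combination (-π (X i)) * hj' + algebraMap k S (u j)⁻¹ * hij
  have hπ : π p = 0 := by
    have : π = MvPolynomial.aeval (fun i => z * algebraMap k S (u i)) := algHom_ext (by simpa using hz)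
    have hval := aeval_algebraMap_apply S u p
    rw [h, map_zero] at hval
    rw [this, hp.aeval_mul]
    exact (congrArg _ hval).trans (mul_zero _)
  exact Ideal.mem_span_singleton.mp (Ideal.Quotient.eq_zero_iff_mem.mp hπ)

/-- A binary form of positive degree over an algebraically closed field has a linear factor. -/
theorem MvPolynomial.IsHomogeneous.exists_linear_dvd {k : Type*} [Field k] [IsAlgClosed k]
    {p : MvPolynomial (Fin 2) k} {m : ℕ} (hp : p.IsHomogeneous m) (hm : m ≠ 0) :
    ∃ a b : k, ¬(a = 0 ∧ b = 0) ∧ (C a * X 0 + C b * X 1 : MvPolynomial (Fin 2) k) ∣ p := by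
  obtain ⟨u, hu, hup⟩ : ∃ u : Fin 2 → k, u ≠ 0 ∧ MvPolynomial.aeval u p = 0 := by
    by_cases h : MvPolynomial.aeval ![(1 : k), 0] p = 0
    · exact ⟨_, fun h0 => one_ne_zero (congrFun h0 0), h⟩
    · set F : Polynomial k := MvPolynomial.aeval (fun i => Polynomial.C ((![0, 1] : Fin 2 → k) i)
        + Polynomial.X * Polynomial.C ((![1, 0] : Fin 2 → k) i)) p with hF
      have hcoeff : F.coeff m ≠ 0 := by rwa [hF, hp.coeff_aeval_line]
      have hdeg : F.degree ≠ 0 := fun h0 =>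
        hm (Nat.le_zero.mp ((Polynomial.le_natDegree_of_ne_zero hcoeff).trans
          (Polynomial.natDegree_eq_of_degree_eq_some h0).le))
      obtain ⟨c, hc⟩ := IsAlgClosed.exists_root F hdeg
      refine ⟨![c, 1], fun h0 => one_ne_zero (congrFun h0 1), ?_⟩
      have : (Polynomial.aeval c).comp (MvPolynomial.aeval (fun i => Polynomial.C ((![0, 1] : Fin 2 → k) i)
          + Polynomial.X * Polynomial.C ((![1, 0] : Fin 2 → k) i)))
          = (MvPolynomial.aeval ![c, 1] : MvPolynomial (Fin 2) k →ₐ[k] k) := by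
        refine algHom_ext fun i => ?_
        fin_cases i <;> simp
      rw [← this, AlgHom.comp_apply, ← hF, Polynomial.coe_aeval_eq_eval]
      exact hc
  refine ⟨u 1, -u 0, ?_, hp.linear_dvd_of_aeval_eq_zero u hu hup⟩
  rintro ⟨h1, h0⟩
  refine hu (_root_.funext fun i => ?_)
  fin_cases i
  · simpa using h0
  · simpa using h1

/-- A squarefree polynomial whose degree is smaller than the characteristic is separable. -/
theorem Squarefree.separable_of_natCast_ne_zero {K : Type*} [Field K] {F : Polynomial K}
    (hF : Squarefree F) (hchar : ∀ e : ℕ, e ≠ 0 → e ≤ F.natDegree → (e : K) ≠ 0) :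
    F.Separable := by
  refine isCoprime_of_irreducible_dvd (fun h => hF.ne_zero h.1) ?_
  rintro p hp ⟨q, rfl⟩ hdvd
  have hq : ¬ p ∣ q := fun h => hp.not_isUnit (hF p (mul_dvd_mul_left p h))
  rw [Polynomial.derivative_mul, dvd_add_left (dvd_mul_right p _)] at hdvd
  have hder := (hp.prime.dvd_or_dvd hdvd).resolve_right hq
  have hpos : p.natDegree ≠ 0 := hp.natDegree_pos.ne'
  have hzero : Polynomial.derivative p = 0 :=
    Polynomial.eq_zero_of_dvd_of_degree_lt hder (Polynomial.degree_derivative_lt hp.ne_zero)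
  have hle : p.natDegree ≤ (p * q).natDegree :=
    Polynomial.natDegree_le_of_dvd (dvd_mul_right p q) hF.ne_zero
  have hcoeff := congrArg (fun r => Polynomial.coeff r (p.natDegree - 1)) hzero
  simp only [Polynomial.coeff_derivative, Polynomial.coeff_zero] at hcoeff
  rw [← Nat.cast_succ, Nat.succ_eq_add_one, Nat.sub_add_cancel hp.natDegree_pos] at hcoeff
  exact (mul_ne_zero (Polynomial.leadingCoeff_ne_zero.mpr hp.ne_zero)
    (hchar _ hpos hle)) hcoeff

/-- A monic squarefree polynomial over an integrally closed domain stays squarefree over the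
fraction field. -/
theorem Polynomial.Monic.squarefree_map_fractionRing {R K : Type*} [CommRing R] [IsDomain R]
    [IsIntegrallyClosed R] [Field K] [Algebra R K] [IsFractionRing R K] {F : Polynomial R}
    (hF : F.Monic) (hsq : Squarefree F) : Squarefree (F.map (algebraMap R K)) := by
  intro g hg
  have hg0 : g ≠ 0 := by
    rintro rfl
    exact (hF.map (algebraMap R K)).ne_zero (zero_dvd_iff.mp (by simpa using hg))
  have hlead : g.leadingCoeff ≠ 0 := Polynomial.leadingCoeff_ne_zero.mpr hg0
  obtain ⟨r, hr⟩ := IsIntegrallyClosed.eq_map_mul_C_of_dvd K hF (dvd_of_mul_left_dvd hg)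
  have hmonic : r.Monic := by
    have h := congrArg Polynomial.leadingCoeff hr
    rw [Polynomial.leadingCoeff_mul, Polynomial.leadingCoeff_C] at h
    exact Polynomial.monic_of_injective (FaithfulSMul.algebraMap_injective R K)
      (mul_right_cancel₀ hlead (h.trans (one_mul _).symm))
  have hdvd : r * r ∣ F := by
    refine hF.dvd_of_fraction_map_dvd_fraction_map (K := K) (hmonic.mul hmonic) ?_
    rw [Polynomial.map_mul]
    have hrg : r.map (algebraMap R K) ∣ g := ⟨_, hr.symm⟩
    exact (mul_dvd_mul hrg hrg).trans hg
  rw [← hr]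
  exact ((hsq r hdvd).map (Polynomial.mapRingHom (algebraMap R K))).mul
    (Polynomial.isUnit_C.mpr hlead.isUnit)

/-- A polynomial that is separable over the fraction field satisfies a Bézout identity with its
derivative up to a nonzero constant. -/
theorem Polynomial.exists_bezout_of_separable_map {R K : Type*} [CommRing R] [IsDomain R]
    [Field K] [Algebra R K] [IsFractionRing R K] {F : Polynomial R}
    (hF : (F.map (algebraMap R K)).Separable) :
    ∃ (a b : Polynomial R) (c : R), c ≠ 0 ∧ a * F + b * derivative F = Polynomial.C c := by
  obtain ⟨a, b, hab⟩ := hF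
  obtain ⟨s, hs0, hs⟩ := IsLocalization.integerNormalization_spec (nonZeroDivisors R) a
  obtain ⟨t, ht0, ht⟩ := IsLocalization.integerNormalization_spec (nonZeroDivisors R) b
  refine ⟨Polynomial.C t * IsLocalization.integerNormalization (nonZeroDivisors R) a,
    Polynomial.C s * IsLocalization.integerNormalization (nonZeroDivisors R) b,
    s * t, nonZeroDivisors.ne_zero (mul_mem hs0 ht0), ?_⟩
  apply Polynomial.map_injective _ (FaithfulSMul.algebraMap_injective R K)
  simp only [Polynomial.map_add, Polynomial.map_mul, Polynomial.map_C, hs, ht,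
    ← Polynomial.derivative_map, map_mul, Algebra.smul_def]
  linear_combination (Polynomial.C (algebraMap R K s) * Polynomial.C (algebraMap R K t)) * hab

section GenericLine

variable {σ k : Type*} [Field k]

/-- The translation `x ↦ x + X v` as an endomorphism of `k[x][X]`. -/
noncomputable def translateAlong (v : σ → k) :
    Polynomial (MvPolynomial σ k) →+* Polynomial (MvPolynomial σ k) :=
  Polynomial.eval₂RingHom
    (MvPolynomial.aeval fun i => Polynomial.C (X i) + Polynomial.X * Polynomial.C (C (v i)) :
      MvPolynomial σ k →ₐ[k] Polynomial (MvPolynomial σ k)).toRingHom Polynomial.X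

theorem translateAlong_C (v : σ → k) (f : MvPolynomial σ k) :
    translateAlong v (Polynomial.C f)
      = MvPolynomial.aeval (fun i => Polynomial.C (X i) + Polynomial.X * Polynomial.C (C (v i))) f := by
  simp [translateAlong]

theorem translateAlong_X (v : σ → k) : translateAlong v Polynomial.X = Polynomial.X := by
  simp [translateAlong]

theorem translateAlong_neg_apply (v : σ → k) (p : Polynomial (MvPolynomial σ k)) :
    translateAlong (-v) (translateAlong v p) = p := by
  have : (translateAlong (-v)).comp (translateAlong v) = RingHom.id _ := by
    refine Polynomial.ringHom_ext' (MvPolynomial.ringHom_ext (fun c => ?_) fun i => ?_) ?_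
    · simp [translateAlong_C]
    · simp [translateAlong_C, translateAlong_X]
      ring
    · simp [translateAlong_X]
  exact congrArg (fun φ : _ →+* _ => φ p) this

/-- The restriction of a squarefree polynomial to the generic line of direction `v` is
squarefree. -/
theorem Squarefree.translateAlong_C {f : MvPolynomial σ k} (hf : Squarefree f) (v : σ → k) :
    Squarefree (translateAlong v (Polynomial.C f)) := by
  intro a ha
  have hdvd : translateAlong (-v) a * translateAlong (-v) a ∣ Polynomial.C f := by
    have := map_dvd (translateAlong (-v)) ha
    rwa [map_mul, translateAlong_neg_apply] at this
  have hC0 : Polynomial.C f ≠ 0 := Polynomial.C_ne_zero.mpr hf.ne_zero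
  have hdeg : (translateAlong (-v) a).natDegree = 0 := by
    have := Polynomial.natDegree_le_of_dvd (dvd_of_mul_left_dvd hdvd) hC0
    simpa using this
  rw [Polynomial.eq_C_of_natDegree_eq_zero hdeg, ← Polynomial.C_mul,
    Polynomial.C_dvd_iff_dvd_coeff] at hdvd
  have hunit : IsUnit (translateAlong (-v) a) := by
    rw [Polynomial.eq_C_of_natDegree_eq_zero hdeg]
    exact Polynomial.isUnit_C.mpr (hf _ (by simpa using hdvd 0))
  have := hunit.map (translateAlong v)
  rwa [show translateAlong v (translateAlong (-v) a) = a by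
    simpa using translateAlong_neg_apply (-v) a] at this

/-- A squarefree form taking the value `1` at `v` restricts to a separable polynomial on some
line of direction `v`. -/
theorem MvPolynomial.IsHomogeneous.exists_separable_restriction [Infinite k]
    {f : MvPolynomial σ k} {d : ℕ} (hf : f.IsHomogeneous d) (hsq : Squarefree f)
    (hchar : ∀ e : ℕ, e ≠ 0 → e ≤ d → (e : k) ≠ 0) {v : σ → k} (hv : MvPolynomial.aeval v f = 1) :
    ∃ w : σ → k, (MvPolynomial.aeval (fun i => Polynomial.C (w i) + Polynomial.X * Polynomial.C (v i)) f :
      Polynomial k).Separable := by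
  set F := translateAlong v (Polynomial.C f) with hF
  have hFaeval := translateAlong_C v f
  have hdeg : F.natDegree ≤ d := by
    rw [hF, hFaeval]
    exact hf.natDegree_aeval_line_le _ _
  have hmonic : F.Monic := by
    refine Polynomial.monic_of_natDegree_le_of_coeff_eq_one d hdeg ?_
    rw [hF, hFaeval, hf.coeff_aeval_line X (fun i => C (v i))]
    have := aeval_algebraMap_apply (MvPolynomial σ k) v f
    rw [hv, map_one] at this
    exact this
  let K := FractionRing (MvPolynomial σ k)
  have hsep : (F.map (algebraMap (MvPolynomial σ k) K)).Separable := by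
    refine (hmonic.squarefree_map_fractionRing
      (hsq.translateAlong_C v)).separable_of_natCast_ne_zero fun e he hle => ?_
    have := hchar e he ((hle.trans Polynomial.natDegree_map_le).trans hdeg)
    rw [← map_natCast (algebraMap k K)]
    exact (map_ne_zero _).mpr this
  obtain ⟨a, b, c, hc, hbez⟩ := Polynomial.exists_bezout_of_separable_map hsep
  obtain ⟨w, hw⟩ : ∃ w, eval w c ≠ 0 := by
    by_contra! h
    exact hc (MvPolynomial.funext fun x => by simpa using h x)
  have hmap : F.map (eval w)
      = MvPolynomial.aeval (fun i => Polynomial.C (w i) + Polynomial.X * Polynomial.C (v i)) f := by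
    rw [hF, hFaeval]
    have : (Polynomial.mapRingHom (eval w)).comp
        (MvPolynomial.aeval fun i => Polynomial.C (X i) + Polynomial.X * Polynomial.C (C (v i)) :
          MvPolynomial σ k →ₐ[k] Polynomial (MvPolynomial σ k)).toRingHom
        = (MvPolynomial.aeval fun i => Polynomial.C (w i) + Polynomial.X * Polynomial.C (v i) :
          MvPolynomial σ k →ₐ[k] Polynomial k).toRingHom := by
      refine MvPolynomial.ringHom_ext (fun r => ?_) fun i => ?_
      · simp
      · simp
    exact congrArg (fun φ : _ →+* _ => φ f) this
  refine ⟨w, hmap ▸ ?_⟩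
  have hspec := congrArg (Polynomial.map (eval w)) hbez
  simp only [Polynomial.map_add, Polynomial.map_mul, Polynomial.map_C,
    ← Polynomial.derivative_map] at hspec
  refine ⟨Polynomial.C (eval w c)⁻¹ * a.map (eval w),
    Polynomial.C (eval w c)⁻¹ * b.map (eval w), ?_⟩
  have hone : Polynomial.C (eval w c)⁻¹ * Polynomial.C (eval w c) = 1 := by
    rw [← Polynomial.C_mul, inv_mul_cancel₀ hw, Polynomial.C_1]
  linear_combination Polynomial.C (eval w c)⁻¹ * hspec + hone

end GenericLine

/-- A polynomial taking the value `1` at `v` whose restriction to the line `w + X v` is separable has no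
repeated root on the projective line through `v` and `w`. -/
theorem not_sq_dvd_of_separable {σ k : Type*} [Field k] {f : MvPolynomial σ k}
    {v w : σ → k} (hv : MvPolynomial.aeval v f = 1)
    (hsep : (MvPolynomial.aeval (fun i => Polynomial.C (w i) + Polynomial.X * Polynomial.C (v i)) f :
      Polynomial k).Separable) {a b : k} (hab : ¬(a = 0 ∧ b = 0)) :
    ¬ (C a * X 0 + C b * X 1 : MvPolynomial (Fin 2) k) ^ 2 ∣
      bind₁ (fun i => (X 0 * C (v i) + X 1 * C (w i) : MvPolynomial (Fin 2) k)) f := by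
  intro hdvd
  have ha : a = 0 := by
    have h := map_dvd (MvPolynomial.aeval ![Polynomial.X, 1] : MvPolynomial (Fin 2) k →ₐ[k] Polynomial k) hdvd
    rw [aeval_bind₁] at h
    simp only [map_pow, map_add, map_mul, aeval_X, aeval_C, Polynomial.algebraMap_eq,
      Matrix.cons_val_zero, Matrix.cons_val_one, mul_one, one_mul] at h
    simp only [add_comm (Polynomial.X * _)] at h
    by_contra ha
    have hunit := hsep.squarefree _ (sq (Polynomial.C a * Polynomial.X + Polynomial.C b) ▸ h)
    have := Polynomial.natDegree_eq_zero_of_isUnit hunit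
    rw [Polynomial.natDegree_linear ha] at this
    exact one_ne_zero this
  subst ha
  have h := map_dvd (MvPolynomial.aeval ![1, 0] : MvPolynomial (Fin 2) k →ₐ[k] k) hdvd
  rw [aeval_bind₁] at h
  simp [hv] at h

/-- A nonzero degree-`d` form `f` in `n+1` variables has the
property that its restriction to every line of `Pⁿ` has a repeated root (i.e.
the binary form `f(sv + tw)` is divisible by the square of a nonzero binary
linear form, for every line spanned by independent `v, w`) if and only if `f`
is divisible by the square of some non-constant polynomial. -/
theorem every_line_tangent_iff_nonreduced {k : Type*} [Field k] [IsAlgClosed k]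
    (n d : ℕ) (hn : 2 ≤ n) (hd : 2 ≤ d)
    (hchar : ringChar k = 0 ∨ d < ringChar k)
    (f : MvPolynomial (Fin (n + 1)) k) (hf : f.IsHomogeneous d) (hf0 : f ≠ 0) :
    (∀ v w : Fin (n + 1) → k, LinearIndependent k ![v, w] →
      ∃ a b : k, ¬(a = 0 ∧ b = 0) ∧
        ((C a * X 0 + C b * X 1 : MvPolynomial (Fin 2) k) ^ 2 ∣
          MvPolynomial.bind₁
            (fun i : Fin (n + 1) =>
              (X 0 * C (v i) + X 1 * C (w i) : MvPolynomial (Fin 2) k)) f)) ↔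
      ∃ q : MvPolynomial (Fin (n + 1)) k, q.totalDegree ≠ 0 ∧ q ^ 2 ∣ f := by
  constructor
  · intro hlines
    by_contra! hno
    have hsq : Squarefree f := by
      intro q hq
      have hdeg : q.totalDegree = 0 := by
        by_contra h
        exact hno q h (sq q ▸ hq)
      rw [totalDegree_eq_zero_iff_eq_C] at hdeg
      rw [hdeg] at hq ⊢
      refine (IsUnit.mk0 _ fun h0 => hf0 ?_).map C
      simpa [h0] using hq
    have hcast : ∀ e : ℕ, e ≠ 0 → e ≤ d → (e : k) ≠ 0 := by
      intro e he hle h0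
      have hdvd := (ringChar.spec k e).mp h0
      rcases hchar with h | h
      · exact he (by simpa [h] using hdvd)
      · exact absurd (Nat.le_of_dvd (Nat.pos_of_ne_zero he) hdvd) (by omega)
    obtain ⟨v, hv⟩ : ∃ v, MvPolynomial.aeval v f = (1 : k) := by
      obtain ⟨u, hu⟩ : ∃ u, eval u f ≠ 0 := by
        by_contra! h
        exact hf0 (MvPolynomial.funext fun x => by simpa using h x)
      obtain ⟨z, hz⟩ := IsAlgClosed.exists_pow_nat_eq (eval u f)⁻¹ (show 0 < d by omega)
      exact ⟨_, (hf.aeval_mul z u).trans (by rw [hz]; exact inv_mul_cancel₀ hu)⟩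
    obtain ⟨w, hw⟩ := hf.exists_separable_restriction hsq hcast hv
    have hv0 : v ≠ 0 := by
      rintro rfl
      have := hf.aeval_mul (0 : k) (0 : Fin (n + 1) → k)
      simp only [zero_mul, zero_pow (show d ≠ 0 by omega)] at this
      exact zero_ne_one (this.symm.trans hv)
    have hind : LinearIndependent k ![v, w] := by
      refine (LinearIndependent.pair_iff' hv0).mpr fun c hc => ?_
      have hpow : (MvPolynomial.aeval (fun i => Polynomial.C (w i) + Polynomial.X * Polynomial.C (v i)) f :
          Polynomial k) = (Polynomial.X + Polynomial.C c) ^ d := by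
        have hfun : (fun i => Polynomial.C (w i) + Polynomial.X * Polynomial.C (v i))
            = fun i => (Polynomial.X + Polynomial.C c) * algebraMap k (Polynomial k) (v i) := by
          funext i
          simp [← hc, Polynomial.algebraMap_eq]
          ring
        have hval := aeval_algebraMap_apply (Polynomial k) v f
        rw [hv, map_one] at hval
        rw [hfun, hf.aeval_mul]
        exact (congrArg _ hval).trans (mul_one _)
      rw [hpow] at hw
      exact Polynomial.not_isUnit_X_add_C c
        (hw.squarefree _ (sq (Polynomial.X + Polynomial.C c) ▸ pow_dvd_pow _ hd))
    obtain ⟨a, b, hab, hdvd⟩ := hlines v w hind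
    exact not_sq_dvd_of_separable hv hw hab hdvd
  · rintro ⟨q, hq, hqf⟩ v w -
    obtain ⟨g, hg, hgf⟩ := hf.exists_isHomogeneous_sq_dvd hf0 hqf
    have hres := hg.aeval (n := 1)
      (fun i => (X 0 * C (v i) + X 1 * C (w i) : MvPolynomial (Fin 2) k)) fun i =>
        ((isHomogeneous_X k 0).mul (isHomogeneous_C _ _)).add
          ((isHomogeneous_X k 1).mul (isHomogeneous_C _ _))
    obtain ⟨a, b, hab, hdvd⟩ := hres.exists_linear_dvd (by simpa using hq)
    refine ⟨a, b, hab, (pow_dvd_pow_of_dvd hdvd 2).trans ?_⟩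
    have := map_dvd (bind₁ fun i =>
      (X 0 * C (v i) + X 1 * C (w i) : MvPolynomial (Fin 2) k)) hgf
    rwa [map_pow] at this
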